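/- Fix agents i and j, a state θ̃ ∈ Θ, agent j's type θ̃_j at θ̃, and a type θ_j ∈ Θ_j (agent j's true type). Suppose 𝓢𝓛_j(f(θ̃),θ̃_j) ∩ 𝓢𝓤_j(f(θ̃),θ_j) ≠ ∅, and let y_i, y_j ∈ X̄ be outcomes with u_j(½ y_i ⊕ ½ y_j, θ_j) − u_j(f(θ̃),θ_j) > −3η. Then there exists x ∈ X̄ with x ∈ 𝓢𝓛_j(f(θ̃),θ̃_j) such that, setting e = min{ρ(x,f(θ̃))^3, 1} and C = e·(½ y_i ⊕ ½ y_j) ⊕ (1−e)·ℓ(x,θ̃), one has u_j(C,θ_j) > u_j(f(θ̃),θ_j). -/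

import Mathlib

/-!
STATEMENT 18 (cf. Lemma 8): Fix agents i and j, a state θ̃ ∈ Θ, agent j's type θ̃_j at θ̃,
and agent j's true type θ_j. Suppose 𝓢𝓛_j(f(θ̃),θ̃_j) ∩ 𝓢𝓤_j(f(θ̃),θ_j) ≠ ∅, and let
y_i, y_j ∈ X̄ satisfy u_j(½ y_i ⊕ ½ y_j, θ_j) − u_j(f(θ̃),θ_j) > −3η. Then there exists
x ∈ X̄ with x ∈ 𝓢𝓛_j(f(θ̃),θ̃_j) such that, setting e = min{ρ(x,f(θ̃))³, 1} and
C = e·(½ y_i ⊕ ½ y_j) ⊕ (1−e)·ℓ(x,θ̃), one has u_j(C,θ_j) > u_j(f(θ̃),θ_j).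

Outcomes are represented in the ambient space `V = (A → ℝ) × ℝ^I`;
`X̄ = Δ(A) × [−2η,2η]^I` and `ρ` is the Euclidean metric.
-/

open scoped BigOperators Classical

noncomputable section

variable {A Θ : Type} {I : ℕ}

/-- The ambient representation space `ℝ^{|A|} × ℝ^I` of outcomes. -/
abbrev Amb (A : Type) (I : ℕ) : Type := (A → ℝ) × (Fin I → ℝ)

/-- The compact outcome space `X̄ = Δ(A) × [−2η,2η]^I`. -/
def XbarSet (A : Type) [Fintype A] (I : ℕ) (η : ℝ) : Set (Amb A I) :=
  {x | x.1 ∈ stdSimplex ℝ A ∧ ∀ i, |x.2 i| ≤ 2 * η}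

/-- The compound outcome `α·x ⊕ (1−α)·x'`. -/
def mixO (α : ℝ) (x x' : Amb A I) : Amb A I :=
  (fun a => α * x.1 a + (1 - α) * x'.1 a, fun i => α * x.2 i + (1 - α) * x'.2 i)

/-- The Euclidean metric `ρ` on the ambient space. -/
def rho [Fintype A] (x y : Amb A I) : ℝ :=
  Real.sqrt ((∑ a, (x.1 a - y.1 a) ^ 2) + ∑ i, (x.2 i - y.2 i) ^ 2)

/-- Agent `j`'s quasilinear utility given the utility vector `t` of his type. -/
def uAmb [Fintype A] (j : Fin I) (x : Amb A I) (t : A → ℝ) : ℝ :=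
  (∑ a, x.1 a * t a) + x.2 j

/-- The compound lottery `ℓ(x,θ̃) = [ρ/(1+ρ)]·x ⊕ [1/(1+ρ)]·f(θ̃)`. -/
def ellMix [Fintype A] (x y : Amb A I) : Amb A I :=
  mixO (rho x y / (1 + rho x y)) x y

theorem uAmb_mixO [Fintype A] (j : Fin I) (α : ℝ) (x y : Amb A I) (t : A → ℝ) :
    uAmb j (mixO α x y) t = α * uAmb j x t + (1 - α) * uAmb j y t := by
  simp only [uAmb, mixO, add_mul, Finset.sum_add_distrib, mul_add, Finset.mul_sum, mul_assoc]
  ring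

theorem mixO_mem_XbarSet [Fintype A] {η α : ℝ} (h0 : 0 ≤ α) (h1 : α ≤ 1) {x y : Amb A I}
    (hx : x ∈ XbarSet A I η) (hy : y ∈ XbarSet A I η) : mixO α x y ∈ XbarSet A I η := by
  refine ⟨convex_stdSimplex ℝ A hx.1 hy.1 h0 (sub_nonneg.2 h1) (by ring), fun k => ?_⟩
  have hxk := abs_le.1 (hx.2 k)
  have hyk := abs_le.1 (hy.2 k)
  simp only [mixO]
  rw [abs_le]
  constructor <;> nlinarith

theorem rho_mixO_left [Fintype A] {α : ℝ} (h0 : 0 ≤ α) (x y : Amb A I) :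
    rho (mixO α x y) y = α * rho x y := by
  unfold rho mixO
  rw [← Real.sqrt_sq h0, ← Real.sqrt_mul (sq_nonneg _), Real.sqrt_sq h0, mul_add,
    Finset.mul_sum, Finset.mul_sum]
  congr 2 <;> exact Finset.sum_congr rfl fun _ _ => by ring

theorem rho_nonneg [Fintype A] (x y : Amb A I) : 0 ≤ rho x y := Real.sqrt_nonneg _

theorem eq_of_rho_eq_zero [Fintype A] {x y : Amb A I} (h : rho x y = 0) : x = y := by
  have hA : 0 ≤ ∑ a, (x.1 a - y.1 a) ^ 2 := Finset.sum_nonneg fun _ _ => sq_nonneg _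
  have hI : 0 ≤ ∑ i, (x.2 i - y.2 i) ^ 2 := Finset.sum_nonneg fun _ _ => sq_nonneg _
  obtain ⟨h1, h2⟩ :=
    (add_eq_zero_iff_of_nonneg hA hI).1 ((Real.sqrt_eq_zero (add_nonneg hA hI)).1 h)
  rw [Finset.sum_eq_zero_iff_of_nonneg fun _ _ => sq_nonneg _] at h1 h2
  ext k
  · exact sub_eq_zero.1 (pow_eq_zero_iff two_ne_zero |>.1 (h1 k (Finset.mem_univ k)))
  · exact sub_eq_zero.1 (pow_eq_zero_iff two_ne_zero |>.1 (h2 k (Finset.mem_univ k)))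

/-- On the segment from `y` to `z` the cubic penalty is dominated by the quadratic gain
near `y`. -/
theorem exists_gain_dominates_penalty {η r d : ℝ} (hη : 0 < η) (hr : 0 < r) (hd : 0 < d) :
    ∃ s : ℝ, 0 < s ∧ s ≤ 1 ∧ s * r ≤ 1 / 2 ∧
      (s * r) ^ 3 * (3 * η) < (1 - (s * r) ^ 3) * (s * r / (1 + s * r) * (s * d)) := by
  have hden : 0 < d + 2 * r * d + 6 * η * r ^ 2 := by positivity
  obtain ⟨s, hs⟩ : ∃ s, s = d / (d + 2 * r * d + 6 * η * r ^ 2) := ⟨_, rfl⟩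
  have hs0 : 0 < s := hs ▸ div_pos hd hden
  have hsd : s * d + s * r * d * 2 + s * (6 * η * r ^ 2) = d := by
    rw [hs]; field_simp
  have p1 : 0 < s * d := by positivity
  have p2 : 0 < s * r * d := by positivity
  have p3 : 0 < s * (6 * η * r ^ 2) := by positivity
  have hsr : 0 < s * r := by positivity
  have hhalf : s * r ≤ 1 / 2 := by nlinarith
  refine ⟨s, hs0, by nlinarith, hhalf, ?_⟩
  have hcube : (s * r) ^ 3 ≤ 1 / 8 :=
    (pow_le_pow_left₀ hsr.le hhalf 3).trans (by norm_num)
  have hcoef : 1 / 2 ≤ (1 - (s * r) ^ 3) / (1 + s * r) := by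
    rw [le_div_iff₀ (by positivity)]; linarith
  have hq : 0 < s ^ 2 * r := by positivity
  calc (s * r) ^ 3 * (3 * η) = s ^ 2 * r * (s * (6 * η * r ^ 2)) * (1 / 2) := by ring
    _ < s ^ 2 * r * d * (1 / 2) := by gcongr; linarith
    _ ≤ s ^ 2 * r * d * ((1 - (s * r) ^ 3) / (1 + s * r)) := by gcongr
    _ = (1 - (s * r) ^ 3) * (s * r / (1 + s * r) * (s * d)) := by ring

/-- **Challenging the false state is strictly better under the true type**
(cf. Lemma 8). -/
theorem challenge_strictly_better
    [Fintype A] [Nonempty A]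
    (η : ℝ) (hη : 0 < η)
    (f : Θ → Amb A I) (hf : ∀ θ, f θ ∈ XbarSet A I η)
    (i j : Fin I)
    (θ' : Θ)                                   -- the state θ̃
    (tjAnn : A → ℝ) (htjAnn : ∀ a, tjAnn a ∈ Set.Icc (0:ℝ) 1)  -- agent j's type θ̃_j at θ̃
    (tjTrue : A → ℝ) (htjTrue : ∀ a, tjTrue a ∈ Set.Icc (0:ℝ) 1)  -- agent j's true type θ_j
    -- 𝓢𝓛_j(f(θ̃),θ̃_j) ∩ 𝓢𝓤_j(f(θ̃),θ_j) ≠ ∅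
    (hne : ∃ z ∈ XbarSet A I η,
      uAmb j z tjAnn < uAmb j (f θ') tjAnn ∧ uAmb j (f θ') tjTrue < uAmb j z tjTrue)
    (yi yj : Amb A I) (hyiX : yi ∈ XbarSet A I η) (hyjX : yj ∈ XbarSet A I η)
    (hy : uAmb j (mixO (1/2) yi yj) tjTrue - uAmb j (f θ') tjTrue > -(3 * η)) :
    ∃ x ∈ XbarSet A I η,
      uAmb j x tjAnn < uAmb j (f θ') tjAnn ∧
      uAmb j (f θ') tjTrue <
        uAmb j (mixO (min ((rho x (f θ')) ^ 3) 1) (mixO (1/2) yi yj) (ellMix x (f θ')))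
          tjTrue := by
  obtain ⟨z, hz, hzA, hzT⟩ := hne
  have hr : 0 < rho z (f θ') := (rho_nonneg _ _).lt_of_ne fun h =>
    hzT.ne (congrArg (uAmb j · tjTrue) (eq_of_rho_eq_zero h.symm).symm)
  obtain ⟨s, hs0, hs1, hhalf, hgain⟩ := exists_gain_dominates_penalty hη hr (sub_pos.2 hzT)
  refine ⟨mixO s z (f θ'), mixO_mem_XbarSet hs0.le hs1 hz (hf θ'), ?_, ?_⟩
  · rw [uAmb_mixO]
    nlinarith
  · have hsr : 0 < s * rho z (f θ') := mul_pos hs0 hr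
    have hcube : (s * rho z (f θ')) ^ 3 ≤ 1 := pow_le_one₀ hsr.le (by linarith)
    rw [ellMix, rho_mixO_left hs0.le, min_eq_left hcube, uAmb_mixO, uAmb_mixO _ (s * _ / _),
      uAmb_mixO _ s]
    have hpen := mul_lt_mul_of_pos_left hy (pow_pos hsr 3)
    linear_combination hgain + hpen

end
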